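/- arXiv:1803.09479 — 2 statements merged into one kernel-verified Lean document; each statement's English description precedes it below -/
import Mathlib

section
/- Fix θ > 0 and θ' > 0, and define σ_h²(θ', θ) = ∫_ℝ F_θ(ω) · (1 − F_{θ'}(ω)/S_{θ',h}(ω)) dω, where F_θ(ω) = θ/(θ² + ω²) and S_{θ',h}(ω) = ∑_{k ∈ ℤ} F_{θ'}(ω + k/h). Then there exist constants C > 0 and h₀ > 0 (depending on θ and θ') such that for all h ∈ (0, h₀], |σ_h²(θ', θ) − (2/3) π² θ h| ≤ C h². -/
open Real MeasureTheory
open scoped FourierTransform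

lemma aux_cot_im (a b : ℝ) (hb : 0 < b) :
    (Complex.cot (a + b * Complex.I)).im = - Real.sinh (2 * b) / (Real.cosh (2 * b) - Real.cos (2 * a)) := by
  have hs : 0 < Real.sinh b := Real.sinh_pos_iff.2 hb
  have hD : Real.cosh (2 * b) - Real.cos (2 * a) = 2 * (Real.sin a ^ 2 * Real.cosh b ^ 2 + Real.cos a ^ 2 * Real.sinh b ^ 2) := by
    rw [Real.cosh_two_mul, Real.cos_two_mul, Real.cosh_sq, ]
    have := Real.sin_sq_add_cos_sq a
    linear_combination (-2 * Real.sinh b ^ 2 - 2) * this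
  have h2 : 0 < Real.sin a ^ 2 * Real.cosh b ^ 2 + Real.cos a ^ 2 * Real.sinh b ^ 2 := by
    rw [Real.cosh_sq]
    have := Real.sin_sq_add_cos_sq a
    nlinarith [sq_nonneg (Real.sin a), pow_pos hs 2]
  rw [Complex.cot, Complex.div_im, Complex.normSq_apply]
  simp only [Complex.cos_add_mul_I, Complex.sin_add_mul_I, ← Complex.ofReal_sin, ← Complex.ofReal_cos, ← Complex.ofReal_sinh, ← Complex.ofReal_cosh]
  simp only [Complex.sub_re, Complex.sub_im, Complex.add_re, Complex.add_im, Complex.mul_re, Complex.mul_im, Complex.ofReal_re, Complex.ofReal_im, Complex.I_re, Complex.I_im]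
  rw [hD, Real.sinh_two_mul, ← sub_div]
  have e : (Real.sin a * Real.cosh b - 0 * 0 + ((Real.cos a * Real.sinh b - 0 * 0) * 0 - (Real.cos a * 0 + 0 * Real.sinh b) * 1)) *
          (Real.sin a * Real.cosh b - 0 * 0 + ((Real.cos a * Real.sinh b - 0 * 0) * 0 - (Real.cos a * 0 + 0 * Real.sinh b) * 1)) +
        (Real.sin a * 0 + 0 * Real.cosh b + ((Real.cos a * Real.sinh b - 0 * 0) * 1 + (Real.cos a * 0 + 0 * Real.sinh b) * 0)) *
          (Real.sin a * 0 + 0 * Real.cosh b + ((Real.cos a * Real.sinh b - 0 * 0) * 1 + (Real.cos a * 0 + 0 * Real.sinh b) * 0)) = Real.sin a ^ 2 * Real.cosh b ^ 2 + Real.cos a ^ 2 * Real.sinh b ^ 2 := by ring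
  rw [e, div_eq_div_iff h2.ne' (by positivity)]
  have := Real.sin_sq_add_cos_sq a
  linear_combination (-2 * Real.sinh b * Real.cosh b * (Real.sin a ^ 2 * Real.cosh b ^ 2 + Real.cos a ^ 2 * Real.sinh b ^ 2)) * this

lemma aux_tsum (c x : ℝ) (hc : 0 < c) :
    ∑' k : ℤ, c / (c ^ 2 + (x + k) ^ 2) =
      π * Real.sinh (2 * (π * c)) / (Real.cosh (2 * (π * c)) - Real.cos (2 * (π * x))) := by
  set z : ℂ := x + c * Complex.I with hz
  have him (r : ℝ) : (1 / (z + r)).im = - (c / (c ^ 2 + (x + r) ^ 2)) := by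
    rw [one_div, Complex.inv_im, Complex.normSq_apply, neg_div]
    simp [hz]
    ring
  have hsum : Summable (fun k : ℤ => c / (c ^ 2 + (x + k) ^ 2)) := by
    have := ((EisensteinSeries.linear_right_summable z 1 (k := 2) le_rfl).norm).mul_left c
    refine this.congr fun k => ?_
    have e : ‖z + k‖ ^ 2 = c ^ 2 + (x + k) ^ 2 := by
      rw [Complex.sq_norm, Complex.normSq_apply]; simp [hz]; ring
    rw [norm_inv, norm_zpow]
    simp only [Int.cast_one, one_mul]
    rw [← e, div_eq_mul_inv]; rfl
  have hzc : z ∈ Complex.integerComplement := 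
    UpperHalfPlane.coe_mem_integerComplement ⟨z, by simp [hz, hc]⟩
  have h1 := cot_series_rep' hzc
  have h2 := summable_cotTerm hzc
  have h3 := congrArg Complex.im h1
  rw [Complex.im_tsum h2] at h3
  have inj1 : Function.Injective (fun n : ℕ => (n : ℤ) + 1) := fun a b h => by simpa using h
  have inj2 : Function.Injective (fun n : ℕ => -((n : ℤ) + 1)) := fun a b h => by simpa using h
  have s1 := hsum.comp_injective inj1
  have s2 := hsum.comp_injective inj2
  have h4 := tsum_of_add_one_of_neg_add_one (f := fun k : ℤ => c / (c ^ 2 + (x + k) ^ 2)) s1 s2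
  have h5 := s2.tsum_add s1
  have h6 : (∑' n : ℕ, (1 / (z - (n + 1)) + 1 / (z + (n + 1))).im) =
      - ∑' n : ℕ, (((fun k : ℤ => c / (c ^ 2 + (x + k) ^ 2)) ∘ fun n : ℕ => -((n : ℤ) + 1)) n +
        ((fun k : ℤ => c / (c ^ 2 + (x + k) ^ 2)) ∘ fun n : ℕ => ((n : ℤ) + 1)) n) := by
    rw [← tsum_neg]
    congr 1
    ext n
    have e1 := him (-(n + 1))
    have e2 := him (n + 1)
    push_cast at e1 e2
    rw [Complex.add_im, sub_eq_add_neg, e1, e2]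
    simp only [Function.comp]
    push_cast
    ring
  have h7 := him 0
  rw [h6, h5, Complex.sub_im] at h3
  have h8 : (π * Complex.cot (π * z)).im = - (π * Real.sinh (2 * (π * c)) / (Real.cosh (2 * (π * c)) - Real.cos (2 * (π * x)))) := by
    have := aux_cot_im (π * x) (π * c) (by positivity)
    rw [Complex.im_ofReal_mul, hz, mul_add, ← mul_assoc]
    push_cast at this
    rw [this]; ring
  rw [h8] at h3
  simp only [Function.comp_def, Complex.ofReal_zero, add_zero] at h3 h7
  rw [h7] at h3
  rw [h4]
  simp only [Int.cast_zero, add_zero]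
  linarith

lemma aux_integrable (β : ℝ) (hβ : 0 < β) : Integrable (fun x : ℝ => 1 / (β ^ 2 + x ^ 2)) := by
  have := (integrable_inv_one_add_sq.comp_div hβ.ne').const_mul (1 / β ^ 2)
  refine this.congr (ae_of_all _ fun x => ?_)
  field_simp

lemma aux_fourier (β w : ℝ) (hβ : 0 < β) :
    𝓕 (fun x : ℝ => Complex.exp (-β * |x|)) w = ((2 * β / (β ^ 2 + (2 * π * w) ^ 2) : ℝ) : ℂ) := by
  rw [Real.fourier_real_eq_integral_exp_smul]
  have e1 : ∀ x ∈ Set.Iic (0:ℝ), Complex.exp (↑(-2 * π * x * w) * Complex.I) • Complex.exp (-β * |x|) = 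
      Complex.exp ((β - 2 * π * w * Complex.I) * x) := by
    intro x hx
    rw [abs_of_nonpos hx, smul_eq_mul, ← Complex.exp_add]
    push_cast; ring_nf
  have e2 : ∀ x ∈ Set.Ioi (0:ℝ), Complex.exp (↑(-2 * π * x * w) * Complex.I) • Complex.exp (-β * |x|) = 
      Complex.exp ((-β - 2 * π * w * Complex.I) * x) := by
    intro x hx
    rw [abs_of_pos hx, smul_eq_mul, ← Complex.exp_add]
    push_cast; ring_nf
  have r1 : 0 < (β - 2 * π * w * Complex.I : ℂ).re := by simp [hβ]
  have r2 : (-β - 2 * π * w * Complex.I : ℂ).re < 0 := by simp [hβ]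
  have i1 := integrableOn_exp_mul_complex_Iic r1 0
  have i2 := integrableOn_exp_mul_complex_Ioi r2 0
  rw [← setIntegral_univ, ← Set.Iic_union_Ioi (a := (0:ℝ)), setIntegral_union (Set.Iic_disjoint_Ioi le_rfl) measurableSet_Ioi
    (i1.congr_fun (fun x hx => (e1 x hx).symm) measurableSet_Iic) (i2.congr_fun (fun x hx => (e2 x hx).symm) measurableSet_Ioi),
    setIntegral_congr_fun measurableSet_Iic e1, setIntegral_congr_fun measurableSet_Ioi e2,
    integral_exp_mul_complex_Iic r1, integral_exp_mul_complex_Ioi r2]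
  have n1 : (β - 2 * π * w * Complex.I : ℂ) ≠ 0 := fun h => by rw [h] at r1; simp at r1
  have n2 : (-β - 2 * π * w * Complex.I : ℂ) ≠ 0 := fun h => by rw [h] at r2; simp at r2
  have n3 : ((β : ℂ) ^ 2 + (2 * π * w) ^ 2 : ℂ) ≠ 0 := by
    have : β ^ 2 + (2 * π * w) ^ 2 ≠ 0 := by positivity
    exact_mod_cast this
  push_cast
  simp only [mul_zero, Complex.exp_zero]
  rw [div_add_div _ _ n1 n2, div_eq_div_iff (mul_ne_zero n1 n2) n3]
  ring_nf
  simp only [Complex.I_sq]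
  ring

lemma aux_exp_integrable (β : ℝ) (hβ : 0 < β) : Integrable (fun x : ℝ => Complex.exp (-β * |x|)) := by
  have r1 : 0 < (β  : ℂ).re := by simp [hβ]
  have r2 : (-β : ℂ).re < 0 := by simp [hβ]
  have i1 := integrableOn_exp_mul_complex_Iic r1 0
  have i2 := integrableOn_exp_mul_complex_Ioi r2 0
  rw [← integrableOn_univ, ← Set.Iic_union_Ioi (a := (0:ℝ))]
  refine IntegrableOn.union (i1.congr_fun (fun x hx => ?_) measurableSet_Iic) (i2.congr_fun (fun x hx => ?_) measurableSet_Ioi)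
  · rw [abs_of_nonpos hx]; push_cast; ring_nf
  · rw [abs_of_pos hx]

lemma aux_cos_integral (β t : ℝ) (hβ : 0 < β) (ht : 0 ≤ t) :
    ∫ ω : ℝ, Real.cos (t * ω) * (1 / (β ^ 2 + ω ^ 2)) = π / β * Real.exp (-(β * t)) := by
  have hF : 𝓕 (fun x : ℝ => Complex.exp (-β * |x|)) = fun w => ((2 * β / (β ^ 2 + (2 * π * w) ^ 2) : ℝ) : ℂ) := by
    ext w; exact aux_fourier β w hβ
  have hi : Integrable (fun w : ℝ => 2 * β / (β ^ 2 + (2 * π * w) ^ 2)) := by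
    have := ((aux_integrable β hβ).comp_mul_left' (R := 2 * π) (by positivity)).const_mul (2 * β)
    refine this.congr (ae_of_all _ fun x => ?_)
    simp only; ring
  have hinv := Continuous.fourierInv_fourier_eq (f := (fun x : ℝ => Complex.exp (-β * |x|))) (by fun_prop)
    (aux_exp_integrable β hβ) (by rw [hF]; exact hi.ofReal)
  have h1 := congrFun hinv t
  rw [hF, Real.fourierInv_eq'] at h1
  have h2 := congrArg Complex.re h1
  have hIntg : Integrable (fun v : ℝ => Complex.exp (↑(2 * π * inner ℝ v t) * Complex.I) • ((2 * β / (β ^ 2 + (2 * π * v) ^ 2) : ℝ) : ℂ)) := by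
    refine Integrable.mono (hi.ofReal (𝕜 := ℂ)) ?_ (ae_of_all _ fun v => ?_)
    · have hc : Continuous (fun v : ℝ => Complex.exp (↑(2 * π * inner ℝ v t) * Complex.I)) := by fun_prop
      exact AEStronglyMeasurable.smul hc.aestronglyMeasurable (hi.ofReal (𝕜 := ℂ)).aestronglyMeasurable
    · rw [norm_smul, Complex.norm_exp_ofReal_mul_I, one_mul]; exact le_rfl
  rw [← RCLike.re_eq_complex_re, ← integral_re hIntg] at h2
  have h3 := Measure.integral_comp_mul_left (fun ω : ℝ => Real.cos (t * ω) * (2 * β * (1 / (β ^ 2 + ω ^ 2)))) (2 * π)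
  have h4 : (fun v : ℝ => RCLike.re (Complex.exp (↑(2 * π * inner ℝ v t) * Complex.I) • ((2 * β / (β ^ 2 + (2 * π * v) ^ 2) : ℝ) : ℂ)))
      = fun v : ℝ => Real.cos (t * (2 * π * v)) * (2 * β * (1 / (β ^ 2 + (2 * π * v) ^ 2))) := by
    ext v
    rw [smul_eq_mul, RCLike.re_eq_complex_re, Complex.re_mul_ofReal, Complex.exp_ofReal_mul_I_re]
    have hin : inner ℝ v t = t * v := by simp [inner]
    rw [hin, show 2 * π * (t * v) = t * (2 * π * v) by ring]
    ring
  rw [h4, h3] at h2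
  have h5 : RCLike.re (Complex.exp (-β * |t|)) = Real.exp (-(β * t)) := by
    rw [abs_of_nonneg ht, RCLike.re_eq_complex_re, ← Complex.exp_ofReal_re]
    push_cast; ring_nf
  rw [h5, smul_eq_mul] at h2
  have h6 : (fun ω : ℝ => Real.cos (t * ω) * (2 * β * (1 / (β ^ 2 + ω ^ 2)))) = fun ω : ℝ => 2 * β * (Real.cos (t * ω) * (1 / (β ^ 2 + ω ^ 2))) := by
    ext; ring
  rw [h6, integral_const_mul, abs_of_pos (by positivity)] at h2
  rw [← h2]
  field_simp

lemma aux_bdd_integrable (f : ℝ → ℝ) (hf : Continuous f) (β K : ℝ) (hβ : 0 < β)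
    (h : ∀ x, |f x| * (β ^ 2 + x ^ 2) ≤ K) : Integrable f := by
  refine Integrable.mono' ((aux_integrable β hβ).const_mul K) hf.aestronglyMeasurable (ae_of_all _ fun x => ?_)
  rw [mul_one_div, Real.norm_eq_abs, le_div_iff₀ (by positivity)]
  exact h x

lemma aux_zero_integral (β : ℝ) (hβ : 0 < β) : ∫ ω : ℝ, 1 / (β ^ 2 + ω ^ 2) = π / β := by
  simpa using aux_cos_integral β 0 hβ le_rfl

lemma aux_prod_integrable (α β : ℝ) (hα : 0 < α) (hβ : 0 < β) :
    Integrable (fun ω : ℝ => 1 / ((α ^ 2 + ω ^ 2) * (β ^ 2 + ω ^ 2))) := by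
  refine aux_bdd_integrable _ (Continuous.div (by fun_prop) (by fun_prop) fun x => by positivity) α (1 / β ^ 2) hα fun x => ?_
  rw [abs_of_nonneg (by positivity), one_div_mul_eq_div, div_le_div_iff₀ (by positivity) (by positivity)]
  nlinarith [mul_nonneg (sq_nonneg α) (sq_nonneg x), mul_nonneg (sq_nonneg x) (sq_nonneg x)]

lemma aux_prod_integral (α β : ℝ) (hα : 0 < α) (hβ : 0 < β) :
    ∫ ω : ℝ, 1 / ((α ^ 2 + ω ^ 2) * (β ^ 2 + ω ^ 2)) = π / (α * β * (α + β)) := by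
  by_cases hne : α = β
  · subst hne
    have hd : ∀ x : ℝ, HasDerivAt (fun x => x / (α ^ 2 + x ^ 2))
        (2 * α ^ 2 * (1 / ((α ^ 2 + x ^ 2) * (α ^ 2 + x ^ 2))) - 1 / (α ^ 2 + x ^ 2)) x := by
      intro x
      have hx : α ^ 2 + x ^ 2 ≠ 0 := by positivity
      have := (hasDerivAt_id x).div (((hasDerivAt_id x).pow 2).const_add (α ^ 2)) hx
      refine HasDerivAt.congr_deriv this ?_
      simp only [id, Pi.pow_apply]
      push_cast
      field_simp
      ring
    have hi1 := (aux_prod_integrable α α hα hα).const_mul (2 * α ^ 2)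
    have hi2 := aux_integrable α hα
    have ht : Filter.Tendsto (fun x : ℝ => x⁻¹ * (x ^ 2 / (α ^ 2 + x ^ 2))) (Filter.cocompact ℝ) (nhds 0) := by
      refine squeeze_zero_norm (a := fun x : ℝ => ‖x⁻¹‖) (fun x => ?_) ?_
      · rw [norm_mul]
        refine mul_le_of_le_one_right (norm_nonneg _) ?_
        rw [Real.norm_eq_abs, abs_of_nonneg (by positivity), div_le_one (by positivity)]
        nlinarith [sq_nonneg α]
      · simpa using (Filter.tendsto_inv₀_cobounded (α := ℝ)).norm
    have ht2 : Filter.Tendsto (fun x : ℝ => x / (α ^ 2 + x ^ 2)) (Filter.cocompact ℝ) (nhds 0) := by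
      refine ht.congr fun x => ?_
      by_cases hx : x = 0
      · simp [hx]
      · field_simp
    rw [cocompact_eq_atBot_atTop] at ht2
    have := integral_of_hasDerivAt_of_tendsto hd (hi1.sub hi2) (ht2.mono_left le_sup_left) (ht2.mono_left le_sup_right)
    rw [integral_sub hi1 hi2, integral_const_mul, aux_zero_integral α hα] at this
    field_simp at this ⊢
    linarith
  · have hne2 : α ^ 2 - β ^ 2 ≠ 0 := by
      have : α ^ 2 - β ^ 2 = (α - β) * (α + β) := by ring
      rw [this]
      exact mul_ne_zero (sub_ne_zero.2 hne) (by positivity)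
    have e : (fun ω : ℝ => 1 / ((α ^ 2 + ω ^ 2) * (β ^ 2 + ω ^ 2))) =
        fun ω : ℝ => (1 / (α ^ 2 - β ^ 2)) * (1 / (β ^ 2 + ω ^ 2) - 1 / (α ^ 2 + ω ^ 2)) := by
      ext ω
      have h1 : α ^ 2 + ω ^ 2 ≠ 0 := by positivity
      have h2 : β ^ 2 + ω ^ 2 ≠ 0 := by positivity
      field_simp
      ring
    rw [e, integral_const_mul, integral_sub (aux_integrable β hβ) (aux_integrable α hα),
      aux_zero_integral α hα, aux_zero_integral β hβ]
    have := sub_ne_zero.2 hne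
    have : α + β ≠ 0 := by positivity
    have h3 : α ^ 2 - β ^ 2 = (α - β) * (α + β) := by ring
    rw [h3]
    field_simp

lemma aux_cos_bound (x : ℝ) : |(1 - Real.cos x) - x ^ 2 / 2| ≤ 3 * x ^ 4 := by
  by_cases hx : |x| ≤ 1
  · have h := Real.cos_bound hx
    rw [show |x| ^ 4 = x ^ 4 from Even.pow_abs (by decide) x] at h
    have h4 : 0 ≤ x ^ 4 := by positivity
    rw [abs_le] at h ⊢
    constructor <;> linarith [h.1, h.2]
  · have h2 : 1 ≤ x ^ 2 := by
      rw [← sq_abs]; nlinarith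
    have h4 : x ^ 4 = x ^ 2 * x ^ 2 := by ring
    rw [abs_le, h4]
    constructor <;> nlinarith [Real.cos_le_one x, Real.neg_one_le_cos x]

lemma aux_exp_bound (x : ℝ) (hx : |x| ≤ 1) :
    |Real.exp x - (1 + x + x ^ 2 / 2 + x ^ 3 / 6)| ≤ x ^ 4 := by
  have h := Real.exp_bound hx (n := 4) (by norm_num)
  rw [show |x| ^ 4 = x ^ 4 from Even.pow_abs (by decide) x] at h
  have h4 : 0 ≤ x ^ 4 := by positivity
  norm_num [Finset.sum_range_succ, Nat.factorial] at h
  refine h.trans ?_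
  nlinarith

lemma aux_cont (α β : ℝ) (hα : 0 < α) (hβ : 0 < β) :
    Continuous (fun ω : ℝ => 1 / ((α ^ 2 + ω ^ 2) * (β ^ 2 + ω ^ 2))) :=
  Continuous.div (by fun_prop) (by fun_prop) fun x => by positivity

lemma aux_sq_eq (α β ω : ℝ) (hα : 0 < α) (hβ : 0 < β) :
    ω ^ 2 * (1 / ((α ^ 2 + ω ^ 2) * (β ^ 2 + ω ^ 2))) =
      1 / (β ^ 2 + ω ^ 2) - α ^ 2 * (1 / ((α ^ 2 + ω ^ 2) * (β ^ 2 + ω ^ 2))) := by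
  have h1 : α ^ 2 + ω ^ 2 ≠ 0 := by positivity
  have h2 : β ^ 2 + ω ^ 2 ≠ 0 := by positivity
  field_simp
  ring

lemma aux_sq_integrable (α β : ℝ) (hα : 0 < α) (hβ : 0 < β) :
    Integrable (fun ω : ℝ => ω ^ 2 * (1 / ((α ^ 2 + ω ^ 2) * (β ^ 2 + ω ^ 2)))) := by
  simp_rw [fun ω => aux_sq_eq α β ω hα hβ]
  exact (aux_integrable β hβ).sub ((aux_prod_integrable α β hα hβ).const_mul _)

lemma aux_sq_integral (α β : ℝ) (hα : 0 < α) (hβ : 0 < β) :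
    ∫ ω : ℝ, ω ^ 2 * (1 / ((α ^ 2 + ω ^ 2) * (β ^ 2 + ω ^ 2))) = π / (α + β) := by
  simp_rw [fun ω => aux_sq_eq α β ω hα hβ]
  rw [integral_sub (aux_integrable β hβ) ((aux_prod_integrable α β hα hβ).const_mul _),
    integral_const_mul, aux_prod_integral α β hα hβ, aux_zero_integral β hβ]
  field_simp
  ring

lemma aux_cos_mul_integrable (g : ℝ → ℝ) (hg : Integrable g) (t : ℝ) :
    Integrable (fun ω : ℝ => (1 - Real.cos (t * ω)) * g ω) := by
  refine hg.bdd_mul (c := 2) (Continuous.aestronglyMeasurable (by fun_prop)) (ae_of_all _ fun x => ?_)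
  rw [Real.norm_eq_abs, abs_le]
  constructor <;> linarith [Real.cos_le_one (t * x), Real.neg_one_le_cos (t * x)]

lemma aux_Q (t : ℝ) (ht : 0 ≤ t) :
    ∫ ω : ℝ, (1 - Real.cos (t * ω)) * (1 / (((1:ℝ) ^ 2 + ω ^ 2) * ((2:ℝ) ^ 2 + ω ^ 2))) =
      1 / 3 * (π * (1 - Real.exp (-t)) - π / 2 * (1 - Real.exp (-(2 * t)))) := by
  have key (β : ℝ) (hβ : 0 < β) : ∫ ω : ℝ, (1 - Real.cos (t * ω)) * (1 / (β ^ 2 + ω ^ 2)) =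
      π / β * (1 - Real.exp (-(β * t))) := by
    have hi : Integrable (fun ω : ℝ => Real.cos (t * ω) * (1 / (β ^ 2 + ω ^ 2))) := by
      refine ((aux_integrable β hβ).sub (aux_cos_mul_integrable _ (aux_integrable β hβ) t)).congr (ae_of_all _ fun x => ?_)
      simp only [Pi.sub_apply]
      ring
    simp_rw [sub_mul, one_mul]
    rw [integral_sub (aux_integrable β hβ) hi, aux_cos_integral β t hβ ht, aux_zero_integral β hβ]
    ring
  have e : (fun ω : ℝ => (1 - Real.cos (t * ω)) * (1 / (((1:ℝ) ^ 2 + ω ^ 2) * ((2:ℝ) ^ 2 + ω ^ 2)))) =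
      fun ω : ℝ => 1 / 3 * ((1 - Real.cos (t * ω)) * (1 / ((1:ℝ) ^ 2 + ω ^ 2)) -
        (1 - Real.cos (t * ω)) * (1 / ((2:ℝ) ^ 2 + ω ^ 2))) := by
    ext ω
    have h1 : (1:ℝ) ^ 2 + ω ^ 2 ≠ 0 := by positivity
    have h2 : (2:ℝ) ^ 2 + ω ^ 2 ≠ 0 := by positivity
    field_simp
    ring
  rw [e, integral_const_mul, integral_sub (aux_cos_mul_integrable _ (aux_integrable 1 one_pos) t)
    (aux_cos_mul_integrable _ (aux_integrable 2 two_pos) t), key 1 one_pos, key 2 two_pos]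
  simp

lemma aux_r4 (α β : ℝ) (hα : 0 < α) (hβ : 0 < β) :
    Integrable (fun ω : ℝ => ω ^ 4 * (1 / ((α ^ 2 + ω ^ 2) * (β ^ 2 + ω ^ 2)) -
      1 / (((1:ℝ) ^ 2 + ω ^ 2) * ((2:ℝ) ^ 2 + ω ^ 2)))) := by
  refine aux_bdd_integrable _ (Continuous.mul (by fun_prop) ((aux_cont α β hα hβ).sub (aux_cont 1 2 one_pos two_pos)))
    1 (|4 - α ^ 2 * β ^ 2| + |5 - α ^ 2 - β ^ 2|) one_pos fun x => ?_
  have h1 : 0 < α ^ 2 + x ^ 2 := by positivity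
  have h2 : 0 < β ^ 2 + x ^ 2 := by positivity
  have e : x ^ 4 * (1 / ((α ^ 2 + x ^ 2) * (β ^ 2 + x ^ 2)) - 1 / (((1:ℝ) ^ 2 + x ^ 2) * ((2:ℝ) ^ 2 + x ^ 2))) =
      ((4 - α ^ 2 * β ^ 2) + (5 - α ^ 2 - β ^ 2) * x ^ 2) *
        (x ^ 4 / ((α ^ 2 + x ^ 2) * (β ^ 2 + x ^ 2)) * (1 / (((1:ℝ) ^ 2 + x ^ 2) * ((2:ℝ) ^ 2 + x ^ 2)))) := by
    have h3 : (1:ℝ) ^ 2 + x ^ 2 ≠ 0 := by positivity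
    have h4 : (2:ℝ) ^ 2 + x ^ 2 ≠ 0 := by positivity
    field_simp
    ring
  have u1 : x ^ 4 / ((α ^ 2 + x ^ 2) * (β ^ 2 + x ^ 2)) ≤ 1 := by
    rw [div_le_one (by positivity)]
    have : 0 ≤ α ^ 2 * β ^ 2 + (α ^ 2 + β ^ 2) * x ^ 2 := by positivity
    nlinarith
  have u2 : (1 + x ^ 2) * (1 / (((1:ℝ) ^ 2 + x ^ 2) * ((2:ℝ) ^ 2 + x ^ 2)) * (1 ^ 2 + x ^ 2)) ≤ 1 := by
    have h3 : (1:ℝ) ^ 2 + x ^ 2 ≠ 0 := by positivity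
    have e2 : (1 + x ^ 2) * (1 / (((1:ℝ) ^ 2 + x ^ 2) * ((2:ℝ) ^ 2 + x ^ 2)) * (1 ^ 2 + x ^ 2)) = (1 + x ^ 2) / (2 ^ 2 + x ^ 2) := by
      field_simp
    rw [e2, div_le_one (by positivity)]
    linarith
  have u3 : |(4 - α ^ 2 * β ^ 2) + (5 - α ^ 2 - β ^ 2) * x ^ 2| ≤ (|4 - α ^ 2 * β ^ 2| + |5 - α ^ 2 - β ^ 2|) * (1 + x ^ 2) := by
    refine (abs_add_le _ _).trans ?_
    rw [abs_mul, abs_of_nonneg (sq_nonneg x)]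
    nlinarith [abs_nonneg (4 - α ^ 2 * β ^ 2), abs_nonneg (5 - α ^ 2 - β ^ 2), mul_nonneg (abs_nonneg (4 - α ^ 2 * β ^ 2)) (sq_nonneg x)]
  rw [e, abs_mul, abs_of_nonneg (a := x ^ 4 / _ * _) (by positivity)]
  set L := |4 - α ^ 2 * β ^ 2| + |5 - α ^ 2 - β ^ 2|
  have hL : 0 ≤ L := by positivity
  set q := 1 / (((1:ℝ) ^ 2 + x ^ 2) * ((2:ℝ) ^ 2 + x ^ 2)) with hq
  have hq0 : 0 ≤ q := by positivity
  set p := x ^ 4 / ((α ^ 2 + x ^ 2) * (β ^ 2 + x ^ 2)) with hp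
  have hp0 : 0 ≤ p := by positivity
  calc _ ≤ (L * (1 + x ^ 2)) * (1 * q) * (1 ^ 2 + x ^ 2) := by gcongr
    _ = L * ((1 + x ^ 2) * (q * (1 ^ 2 + x ^ 2))) := by ring
    _ ≤ L * 1 := by gcongr
    _ = L := mul_one _

lemma aux_B (α β : ℝ) (hα : 0 < α) (hβ : 0 < β) : ∃ K ≥ (0:ℝ), ∀ t : ℝ, 0 ≤ t → t ≤ 1 / 2 →
    |(∫ ω : ℝ, (1 - Real.cos (t * ω)) * (1 / ((α ^ 2 + ω ^ 2) * (β ^ 2 + ω ^ 2)))) -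
      (t ^ 2 / 2 * (π / (α + β)) - π / 6 * t ^ 3)| ≤ K * t ^ 4 := by
  set P : ℝ → ℝ := fun ω => 1 / ((α ^ 2 + ω ^ 2) * (β ^ 2 + ω ^ 2)) with hP
  set Q : ℝ → ℝ := fun ω => 1 / (((1:ℝ) ^ 2 + ω ^ 2) * ((2:ℝ) ^ 2 + ω ^ 2)) with hQ
  have iP : Integrable P := aux_prod_integrable α β hα hβ
  have iQ : Integrable Q := aux_prod_integrable 1 2 one_pos two_pos
  have iP2 : Integrable (fun ω => ω ^ 2 * P ω) := aux_sq_integrable α β hα hβ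
  have iQ2 : Integrable (fun ω => ω ^ 2 * Q ω) := aux_sq_integrable 1 2 one_pos two_pos
  have i4 : Integrable (fun ω => ω ^ 4 * (P ω - Q ω)) := aux_r4 α β hα hβ
  have vP2 : ∫ ω, ω ^ 2 * P ω = π / (α + β) := aux_sq_integral α β hα hβ
  have vQ2 : ∫ ω, ω ^ 2 * Q ω = π / (1 + 2) := aux_sq_integral 1 2 one_pos two_pos
  set J : ℝ := ∫ ω, |ω ^ 4 * (P ω - Q ω)| with hJ
  have hJ0 : 0 ≤ J := integral_nonneg fun _ => abs_nonneg _
  refine ⟨3 * J + 17 * π, by positivity, fun t ht0 ht1 => ?_⟩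
  have vQ : ∫ ω, (1 - Real.cos (t * ω)) * Q ω = _ := aux_Q t ht0
  have icP := aux_cos_mul_integrable P iP t
  have icQ := aux_cos_mul_integrable Q iQ t
  have i2 : Integrable (fun ω => t ^ 2 / 2 * (ω ^ 2 * P ω - ω ^ 2 * Q ω)) := (iP2.sub iQ2).const_mul _
  have e : (∫ ω, (1 - Real.cos (t * ω)) * P ω) - (∫ ω, (1 - Real.cos (t * ω)) * Q ω) -
      t ^ 2 / 2 * (π / (α + β) - π / (1 + 2)) =
      ∫ ω, ((1 - Real.cos (t * ω)) * P ω - (1 - Real.cos (t * ω)) * Q ω - t ^ 2 / 2 * (ω ^ 2 * P ω - ω ^ 2 * Q ω)) := by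
    have i5 : Integrable (fun ω => (1 - Real.cos (t * ω)) * P ω - (1 - Real.cos (t * ω)) * Q ω) := icP.sub icQ
    rw [integral_sub i5 i2, integral_sub icP icQ, integral_const_mul, integral_sub iP2 iQ2, vP2, vQ2]
  have b : |(∫ ω, (1 - Real.cos (t * ω)) * P ω) - (∫ ω, (1 - Real.cos (t * ω)) * Q ω) -
      t ^ 2 / 2 * (π / (α + β) - π / (1 + 2))| ≤ 3 * t ^ 4 * J := by
    rw [e, hJ, ← integral_const_mul, ← Real.norm_eq_abs]
    refine norm_integral_le_of_norm_le (i4.abs.const_mul _) (ae_of_all _ fun ω => ?_)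
    have e3 : (1 - Real.cos (t * ω)) * P ω - (1 - Real.cos (t * ω)) * Q ω - t ^ 2 / 2 * (ω ^ 2 * P ω - ω ^ 2 * Q ω) =
      ((1 - Real.cos (t * ω)) - (t * ω) ^ 2 / 2) * (P ω - Q ω) := by ring
    rw [e3, norm_mul, Real.norm_eq_abs, Real.norm_eq_abs, abs_mul (ω ^ 4), abs_of_nonneg (a := ω ^ 4) (by positivity), ← mul_assoc]
    refine mul_le_mul_of_nonneg_right ((aux_cos_bound _).trans (le_of_eq (by ring))) (abs_nonneg _)
  rw [vQ] at b
  change |(∫ ω, (1 - Real.cos (t * ω)) * P ω) - (t ^ 2 / 2 * (π / (α + β) ) - π / 6 * t ^ 3)| ≤ _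
  clear e
  generalize (∫ ω, (1 - Real.cos (t * ω)) * P ω) = I at b ⊢
  have x1 := aux_exp_bound (-t) (by rw [abs_neg, abs_of_nonneg ht0]; linarith)
  have x2 := aux_exp_bound (-(2 * t)) (by rw [abs_neg, abs_of_nonneg (by positivity)]; linarith)
  have y1 : |π / 3 * (Real.exp (-t) - (1 + (-t) + (-t) ^ 2 / 2 + (-t) ^ 3 / 6))| ≤ π / 3 * (-t) ^ 4 := by
    rw [abs_mul, abs_of_pos (by positivity : 0 < π / 3)]; gcongr
  have y2 : |π / 6 * (Real.exp (-(2 * t)) - (1 + (-(2 * t)) + (-(2 * t)) ^ 2 / 2 + (-(2 * t)) ^ 3 / 6))| ≤ π / 6 * (-(2 * t)) ^ 4 := by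
    rw [abs_mul, abs_of_pos (by positivity : 0 < π / 6)]; gcongr
  have hpt : 0 ≤ π * t ^ 4 := by positivity
  rw [abs_le] at b y1 y2 ⊢
  constructor <;> ring_nf at b y1 y2 hpt ⊢ <;> linarith [b.1, b.2, y1.1, y1.2, y2.1, y2.2]

lemma aux_sinh_bound (a : ℝ) (h0 : 0 ≤ a) (h1 : a ≤ 1) : |Real.sinh a - a| ≤ 2 * a ^ 3 := by
  have x1 := aux_exp_bound a (by rw [abs_of_nonneg h0]; exact h1)
  have x2 := aux_exp_bound (-a) (by rw [abs_neg, abs_of_nonneg h0]; exact h1)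
  have h3 : 0 ≤ a ^ 3 := by positivity
  have h4 : a ^ 4 ≤ a ^ 3 := by nlinarith
  rw [Real.sinh_eq]
  rw [abs_le] at x1 x2 ⊢
  constructor <;> ring_nf at x1 x2 ⊢ <;> linarith [x1.1, x1.2, x2.1, x2.2]

lemma aux_cosh_bound (a : ℝ) (h0 : 0 ≤ a) (h1 : a ≤ 1) : |Real.cosh a - 1 - a ^ 2 / 2| ≤ a ^ 4 := by
  have x1 := aux_exp_bound a (by rw [abs_of_nonneg h0]; exact h1)
  have x2 := aux_exp_bound (-a) (by rw [abs_neg, abs_of_nonneg h0]; exact h1)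
  rw [Real.cosh_eq]
  rw [abs_le] at x1 x2 ⊢
  constructor <;> ring_nf at x1 x2 ⊢ <;> linarith [x1.1, x1.2, x2.1, x2.2]

lemma aux_sigma (θ θ' h : ℝ) (hθ : 0 < θ) (hθ' : 0 < θ') (hh : 0 < h) :
    (∫ ω : ℝ, θ / (θ ^ 2 + ω ^ 2) *
          (1 - (θ' / (θ' ^ 2 + ω ^ 2)) / ∑' k : ℤ, θ' / (θ' ^ 2 + (ω + (k : ℝ) / h) ^ 2))) =
    π - 2 * θ * θ' / ((2 * π * h) * Real.sinh (θ' * (2 * π * h))) *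
      ((Real.cosh (θ' * (2 * π * h)) - 1) * (π / (θ * θ' * (θ + θ'))) +
        ∫ ω : ℝ, (1 - Real.cos (2 * π * h * ω)) * (1 / ((θ ^ 2 + ω ^ 2) * (θ' ^ 2 + ω ^ 2)))) := by
  have hs : 0 < Real.sinh (θ' * (2 * π * h)) := Real.sinh_pos_iff.2 (by positivity)
  have hS (ω : ℝ) : ∑' k : ℤ, θ' / (θ' ^ 2 + (ω + (k : ℝ) / h) ^ 2) =
      h * (π * Real.sinh (θ' * (2 * π * h)) / (Real.cosh (θ' * (2 * π * h)) - Real.cos (2 * π * h * ω))) := by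
    have := aux_tsum (θ' * h) (ω * h) (by positivity)
    rw [show 2 * (π * (θ' * h)) = θ' * (2 * π * h) by ring, show 2 * (π * (ω * h)) = 2 * π * h * ω by ring] at this
    rw [← this, ← tsum_mul_left]
    congr 1
    ext k
    have h1 : θ' ^ 2 + (ω + (k : ℝ) / h) ^ 2 ≠ 0 := by positivity
    have h2 : (θ' * h) ^ 2 + (ω * h + k) ^ 2 ≠ 0 := by positivity
    have h3 : (θ' * h) ^ 2 + (ω * h + k) ^ 2 = h ^ 2 * (θ' ^ 2 + (ω + (k : ℝ) / h) ^ 2) := by field_simp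
    rw [h3]
    field_simp
  have hc : 1 < Real.cosh (θ' * (2 * π * h)) := Real.one_lt_cosh.2 (by positivity)
  have e : (fun ω : ℝ => θ / (θ ^ 2 + ω ^ 2) *
          (1 - (θ' / (θ' ^ 2 + ω ^ 2)) / ∑' k : ℤ, θ' / (θ' ^ 2 + (ω + (k : ℝ) / h) ^ 2))) =
      fun ω : ℝ => θ * (1 / (θ ^ 2 + ω ^ 2)) - 2 * θ * θ' / ((2 * π * h) * Real.sinh (θ' * (2 * π * h))) *
        ((Real.cosh (θ' * (2 * π * h)) - 1) * (1 / ((θ ^ 2 + ω ^ 2) * (θ' ^ 2 + ω ^ 2))) +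
        (1 - Real.cos (2 * π * h * ω)) * (1 / ((θ ^ 2 + ω ^ 2) * (θ' ^ 2 + ω ^ 2)))) := by
    ext ω
    rw [hS ω]
    have h1 : θ ^ 2 + ω ^ 2 ≠ 0 := by positivity
    have h2 : θ' ^ 2 + ω ^ 2 ≠ 0 := by positivity
    have h3 : Real.cosh (θ' * (2 * π * h)) - Real.cos (2 * π * h * ω) ≠ 0 := by
      have := Real.cos_le_one (2 * π * h * ω)
      intro h; linarith
    have hs' := hs.ne'
    generalize Real.sinh (θ' * (2 * π * h)) = s at *
    generalize Real.cosh (θ' * (2 * π * h)) = c at *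
    generalize Real.cos (2 * π * h * ω) = d at *
    field_simp
    ring
  have i1 := (aux_integrable θ hθ).const_mul θ
  have iP := aux_prod_integrable θ θ' hθ hθ'
  have i2 := iP.const_mul (Real.cosh (θ' * (2 * π * h)) - 1)
  have i3 := aux_cos_mul_integrable _ iP (2 * π * h)
  have i4 : Integrable (fun ω : ℝ => (Real.cosh (θ' * (2 * π * h)) - 1) * (1 / ((θ ^ 2 + ω ^ 2) * (θ' ^ 2 + ω ^ 2))) +
        (1 - Real.cos (2 * π * h * ω)) * (1 / ((θ ^ 2 + ω ^ 2) * (θ' ^ 2 + ω ^ 2)))) := i2.add i3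
  rw [e, integral_sub i1 (i4.const_mul _), integral_const_mul, integral_const_mul,
    integral_add i2 i3, integral_const_mul, aux_zero_integral θ hθ, aux_prod_integral θ θ' hθ hθ']
  congr 1
  field_simp

/-- Quantitative form of the misspecified asymptotics: for the exponential
(Matérn `ν = 1/2`) spectral densities `F_θ(ω) = θ/(θ² + ω²)` and the misspecified
interpolation error `σ_h²(θ', θ) = ∫ F_θ(ω)·(1 − F_{θ'}(ω)/S_{θ',h}(ω)) dω`, where
`S_{θ',h}(ω) = ∑_{k ∈ ℤ} F_{θ'}(ω + k/h)`, there exist `C > 0` and `h₀ > 0`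
(depending on `θ, θ'`) such that for all `h ∈ (0, h₀]`,
`|σ_h²(θ', θ) − (2/3)π²θh| ≤ C h²`. -/
theorem misspecified_interpolation_error_quantitative (θ θ' : ℝ) (hθ : 0 < θ) (hθ' : 0 < θ') :
    ∃ C > (0 : ℝ), ∃ h₀ > (0 : ℝ), ∀ h : ℝ, 0 < h → h ≤ h₀ →
      |(∫ ω : ℝ, θ / (θ ^ 2 + ω ^ 2) *
          (1 - (θ' / (θ' ^ 2 + ω ^ 2)) / ∑' k : ℤ, θ' / (θ' ^ 2 + (ω + (k : ℝ) / h) ^ 2)))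
        - 2 / 3 * π ^ 2 * θ * h| ≤ C * h ^ 2 := by
  obtain ⟨K, hK0, hK⟩ := aux_B θ θ' hθ hθ'
  set M : ℝ := 2 * θ' ^ 3 * (π + π * θ) + 2 * θ' ^ 4 * (π / (θ + θ')) + 2 * θ * θ' * K with hM
  have hM0 : 0 < M := by positivity
  refine ⟨M / θ' * (2 * π) ^ 2, by positivity, min (1 / 2) (1 / θ') / (2 * π), by positivity, fun h hh hle => ?_⟩
  rw [aux_sigma θ θ' h hθ hθ' hh]
  set t : ℝ := 2 * π * h with ht
  have ht0 : 0 < t := by positivity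
  have htm : t ≤ min (1 / 2) (1 / θ') := by
    rw [le_div_iff₀ (by positivity)] at hle
    rw [ht]; linarith
  have ht1 : t ≤ 1 / 2 := htm.trans (min_le_left _ _)
  have ht2 : θ' * t ≤ 1 := by
    have := htm.trans (min_le_right _ _)
    rw [le_div_iff₀ hθ'] at this
    linarith
  have b1 := aux_sinh_bound (θ' * t) (by positivity) ht2
  have b2 := aux_cosh_bound (θ' * t) (by positivity) ht2
  have b3 := hK t ht0.le ht1
  have hsa : θ' * t ≤ Real.sinh (θ' * t) := Real.self_le_sinh_iff.2 (by positivity)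
  set B := ∫ ω : ℝ, (1 - Real.cos (t * ω)) * (1 / ((θ ^ 2 + ω ^ 2) * (θ' ^ 2 + ω ^ 2)))
  set s := Real.sinh (θ' * t)
  set c := Real.cosh (θ' * t)
  have hs0 : 0 < s := lt_of_lt_of_le (by positivity) hsa
  set D := π / (θ + θ') with hD
  have hD0 : 0 < D := by positivity
  have hDe : D * (θ + θ') = π := by rw [hD]; field_simp
  have hDD : π / (θ * θ' * (θ + θ')) = D / (θ * θ') := by rw [hD]; field_simp
  have e : π - 2 * θ * θ' / (t * s) * ((c - 1) * (π / (θ * θ' * (θ + θ'))) + B) - 2 / 3 * π ^ 2 * θ * h =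
      ((π - π * θ * t / 3) * t * (s - θ' * t) - 2 * D * (c - 1 - (θ' * t) ^ 2 / 2)
        - 2 * θ * θ' * (B - (t ^ 2 / 2 * D - π / 6 * t ^ 3))) / (t * s) := by
    rw [hDD, show 2 / 3 * π ^ 2 * θ * h = π * θ * t / 3 by rw [ht]; ring]
    field_simp
    rw [← hDe]
    ring
  rw [e, abs_div, abs_of_pos (by positivity : 0 < t * s), div_le_iff₀ (by positivity)]
  have k0 : |π - π * θ * t / 3| ≤ π + π * θ := by
    have : 0 < π * θ := by positivity
    have : 0 < π := by positivity
    rw [abs_le]; constructor <;> nlinarith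
  have k1 : |(π - π * θ * t / 3) * t * (s - θ' * t)| ≤ (π + π * θ) * t * (2 * (θ' * t) ^ 3) := by
    rw [abs_mul, abs_mul, abs_of_pos ht0]; gcongr
  have k2 : |2 * D * (c - 1 - (θ' * t) ^ 2 / 2)| ≤ 2 * D * (θ' * t) ^ 4 := by
    rw [abs_mul, abs_of_pos (by positivity : 0 < 2 * D)]; gcongr
  have k3 : |2 * θ * θ' * (B - (t ^ 2 / 2 * D - π / 6 * t ^ 3))| ≤ 2 * θ * θ' * (K * t ^ 4) := by
    rw [abs_mul, abs_of_pos (by positivity : 0 < 2 * θ * θ')]; gcongr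
  calc _ ≤ (π + π * θ) * t * (2 * (θ' * t) ^ 3) + 2 * D * (θ' * t) ^ 4 + 2 * θ * θ' * (K * t ^ 4) :=
        (abs_sub _ _).trans (add_le_add ((abs_sub _ _).trans (add_le_add k1 k2)) k3)
    _ = M / θ' * (2 * π) ^ 2 * h ^ 2 * (t * (θ' * t)) := by
        rw [show M / θ' * (2 * π) ^ 2 * h ^ 2 = M / θ' * t ^ 2 by rw [ht]; ring, hM]
        field_simp
    _ ≤ M / θ' * (2 * π) ^ 2 * h ^ 2 * (t * s) := by gcongr
end

section
/- Define, for θ > 0 and h > 0, the squared-exponential spectral density F_θ(ω) = θ^{−1/2}·exp(−ω²/(2θ)) and the interpolation error σ_h²(θ) = ∫_ℝ F_θ(ω) · (∑_{k ∈ ℤ, k ≠ 0} F_θ(ω + k/h)) / (∑_{k ∈ ℤ} F_θ(ω + k/h)) dω. There exists c > 0 such that for all θ > 0 and h > 0 with θh² < c, (4/3)·h·√θ·exp(−1/(8h²θ)) ≤ σ_h²(θ) ≤ 7·h·√θ·exp(−1/(8h²θ)). -/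
open Real MeasureTheory

lemma aux_sech_bound (u : ℝ) : (2 * cosh u)⁻¹ ≤ 2 * (1 + u ^ 2)⁻¹ := by
  have h1 := Real.quadratic_le_exp_of_nonneg (abs_nonneg u)
  have h2 := Real.add_one_le_exp (-|u|)
  have h3 : 2 * cosh u = exp |u| + exp (-|u|) := by
    rw [← Real.cosh_abs, Real.cosh_eq]; ring
  rw [h3, ← div_eq_mul_inv, inv_eq_one_div, div_le_div_iff₀ (by positivity) (by positivity)]
  nlinarith [sq_abs u, sq_nonneg u]

lemma aux_sech_integrable : Integrable (fun u : ℝ => (2 * cosh u)⁻¹) := by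
  refine (integrable_inv_one_add_sq.const_mul 2).mono' ?_ ?_
  · apply Continuous.aestronglyMeasurable
    exact (continuous_const.mul continuous_cosh).inv₀ (fun x => (mul_pos two_pos (Real.cosh_pos x)).ne')
  · refine Filter.Eventually.of_forall fun u => ?_
    rw [Real.norm_of_nonneg (by positivity)]
    exact aux_sech_bound u

lemma aux_sech_integral : ∫ u : ℝ, (2 * cosh u)⁻¹ = π / 2 := by
  have := integral_of_hasDerivAt_of_tendsto (f := fun u => arctan (exp u))
    (f' := fun u : ℝ => (2 * cosh u)⁻¹) (m := 0) (n := π / 2) ?_ aux_sech_integrable ?_ ?_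
  · simpa using this
  · intro x
    have h := (Real.hasDerivAt_exp x).arctan
    have e : 1 / (1 + exp x ^ 2) * exp x = (2 * cosh x)⁻¹ := by
      rw [Real.cosh_eq, Real.exp_neg]
      field_simp
      ring
    rw [e] at h
    exact h
  · have : Filter.Tendsto (fun u : ℝ => arctan (exp u)) Filter.atBot (nhds (arctan 0)) :=
      (continuous_arctan.tendsto 0).comp tendsto_exp_atBot
    simpa using this
  · exact (tendsto_nhds_of_tendsto_nhdsWithin tendsto_arctan_atTop).comp tendsto_exp_atTop

lemma aux_summable_pow (q : ℝ) (h0 : 0 ≤ q) (h1 : q < 1) :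
    HasSum (fun k : ℤ => q ^ k.natAbs) (2 * (1 - q)⁻¹ - 1) := by
  have h := hasSum_geometric_of_lt_one h0 h1
  have := HasSum.of_nat_of_neg (f := fun k : ℤ => q ^ k.natAbs) (by simpa using h) (by simpa using h)
  have e : (1 - q)⁻¹ + (1 - q)⁻¹ - q ^ (0 : ℤ).natAbs = 2 * (1 - q)⁻¹ - 1 := by
    simp; ring
  rw [e] at this
  exact this

lemma aux_split (f : ℤ → ℝ) (hf : Summable f) :
    ∑' k : ℤ, f k = f 0 + ∑' k : {k : ℤ // k ≠ 0}, f k := by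
  have h := hf.tsum_subtype_add_tsum_subtype_compl {(0 : ℤ)}
  rw [← h]
  congr 1
  simp

noncomputable def auxPhi (y : ℝ) : ℝ := exp (-y ^ 2 / 2)

lemma auxPhi_pos (y : ℝ) : 0 < auxPhi y := exp_pos _

lemma auxPhi_summable (a : ℝ) (ha : 0 < a) (x : ℝ) :
    Summable (fun k : ℤ => auxPhi (x + k * a)) := by
  have h := (aux_summable_pow (exp (-a)) (exp_pos _).le (by simpa using ha)).summable.mul_left
    (exp (1 / 2 + |x|))
  refine Summable.of_nonneg_of_le (fun k => (auxPhi_pos _).le) (fun k => ?_) h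
  rw [← Real.exp_nat_mul, ← Real.exp_add, auxPhi]
  apply Real.exp_le_exp.mpr
  have e : ((k.natAbs : ℕ) : ℝ) = |(k : ℝ)| := by
    rw [Nat.cast_natAbs]; simp
  rw [e]
  have h1 : |(k : ℝ)| * a ≤ |x + k * a| + |x| := by
    have := abs_add_le (x + k * a) (-x)
    rw [abs_neg] at this
    rw [show x + k * a + -x = k * a by ring, abs_mul, abs_of_pos ha] at this
    exact this
  nlinarith [sq_abs (x + k * a), sq_nonneg (|x + k * a| - 1)]

/-- the harmonic combination of two Gaussians -/
lemma auxPhi_harm (t b : ℝ) :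
    auxPhi (t - b) * auxPhi (t + b) / (auxPhi (t - b) + auxPhi (t + b))
      = exp (-b ^ 2 / 2) * (exp (-t ^ 2 / 2) * (2 * cosh (b * t))⁻¹) := by
  have h1 : auxPhi (t - b) = exp (-b ^ 2 / 2) * exp (-t ^ 2 / 2) * exp (b * t) := by
    rw [auxPhi, ← exp_add, ← exp_add]; congr 1; ring
  have h2 : auxPhi (t + b) = exp (-b ^ 2 / 2) * exp (-t ^ 2 / 2) * exp (-(b * t)) := by
    rw [auxPhi, ← exp_add, ← exp_add]; congr 1; ring
  have h3 : exp (b * t) * exp (-(b * t)) = 1 := by rw [← exp_add]; simp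
  rw [h1, h2, Real.cosh_eq]
  field_simp
  linear_combination h3

noncomputable def auxG (a x : ℝ) : ℝ :=
  auxPhi x * (∑' k : {k : ℤ // k ≠ 0}, auxPhi (x + (k : ℤ) * a)) / ∑' k : ℤ, auxPhi (x + k * a)

lemma auxPhi_meas : Measurable auxPhi := by unfold auxPhi; fun_prop

lemma aux_tsum_meas {ι : Type*} [Countable ι] (f : ι → ℝ → ℝ) (hf : ∀ i, Measurable (f i))
    (h0 : ∀ i x, 0 ≤ f i x) : Measurable (fun x => ∑' i, f i x) := by
  have : (fun x => ∑' i, f i x) = fun x => (∑' i, ENNReal.ofReal (f i x)).toReal := by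
    ext x
    rw [ENNReal.tsum_toReal_eq (fun _ => ENNReal.ofReal_ne_top)]
    simp [ENNReal.toReal_ofReal, h0]
  rw [this]
  exact (Measurable.tsum fun i => (hf i).ennreal_ofReal).ennreal_toReal

lemma auxG_meas (a : ℝ) : Measurable (auxG a) := by
  unfold auxG
  refine (auxPhi_meas.mul (aux_tsum_meas _ (fun i => ?_) (fun i x => (auxPhi_pos _).le))).div
    (aux_tsum_meas _ (fun i => ?_) (fun i x => (auxPhi_pos _).le))
  · exact auxPhi_meas.comp (by fun_prop)
  · exact auxPhi_meas.comp (by fun_prop)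

lemma auxS_eq (a : ℝ) (ha : 0 < a) (x : ℝ) : ∑' k : ℤ, auxPhi (x + k * a) =
    auxPhi x + ∑' k : {k : ℤ // k ≠ 0}, auxPhi (x + (k : ℤ) * a) := by
  rw [aux_split _ (auxPhi_summable a ha x)]; simp

lemma auxT_ge (a : ℝ) (ha : 0 < a) (x : ℝ) (k : {k : ℤ // k ≠ 0}) :
    auxPhi (x + (k : ℤ) * a) ≤ ∑' k : {k : ℤ // k ≠ 0}, auxPhi (x + (k : ℤ) * a) :=
  ((auxPhi_summable a ha x).subtype _).le_tsum k (fun _ _ => (auxPhi_pos _).le)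

lemma auxG_nonneg (a : ℝ) (x : ℝ) : 0 ≤ auxG a x := by
  unfold auxG
  exact div_nonneg (mul_nonneg (auxPhi_pos _).le (tsum_nonneg fun _ => (auxPhi_pos _).le))
    (tsum_nonneg fun _ => (auxPhi_pos _).le)

lemma auxG_integrable (a : ℝ) (ha : 0 < a) : Integrable (auxG a) := by
  have hi : Integrable auxPhi := by
    have := integrable_exp_neg_mul_sq (b := 1 / 2) (by norm_num)
    refine this.congr (Filter.Eventually.of_forall fun x => ?_)
    simp only [auxPhi]; congr 1; ring
  refine hi.mono' (auxG_meas a).aestronglyMeasurable (Filter.Eventually.of_forall fun x => ?_)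
  rw [Real.norm_of_nonneg (auxG_nonneg a x)]
  have hT : 0 ≤ ∑' k : {k : ℤ // k ≠ 0}, auxPhi (x + (k : ℤ) * a) :=
    tsum_nonneg fun _ => (auxPhi_pos _).le
  have := auxPhi_pos x
  rw [auxG, auxS_eq a ha x, div_le_iff₀ (by positivity)]
  nlinarith

lemma aux_lower (a : ℝ) (ha : 0 < a) (ha2 : 24 < a ^ 2) :
    4 / 3 / a * exp (-a ^ 2 / 8) ≤ ∫ x, auxG a x := by
  set b : ℝ := 1 / 2 + a ^ 2 / 8 with hb
  have hb0 : 0 < b := by positivity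
  have hi : Integrable (fun x : ℝ => exp (-a ^ 2 / 8) * (1 / 2 * exp (-b * (x - a / 2) ^ 2))) :=
    (((integrable_exp_neg_mul_sq hb0).comp_sub_right (a / 2)).const_mul _).const_mul _
  have hle : ∫ x : ℝ, exp (-a ^ 2 / 8) * (1 / 2 * exp (-b * (x - a / 2) ^ 2)) ≤ ∫ x, auxG a x := by
    refine integral_mono hi (auxG_integrable a ha) fun x => ?_
    have hT := auxT_ge a ha x ⟨-1, by norm_num⟩
    simp only [auxG]
    rw [auxS_eq a ha x]
    set T := ∑' k : {k : ℤ // k ≠ 0}, auxPhi (x + (k : ℤ) * a)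
    have hp := auxPhi_pos x
    have hq := auxPhi_pos (x - a)
    have hT' : auxPhi (x - a) ≤ T := by
      refine le_trans (le_of_eq ?_) hT
      congr 1; push_cast; ring
    have h1 : auxPhi x * auxPhi (x - a) / (auxPhi x + auxPhi (x - a)) ≤ auxPhi x * T / (auxPhi x + T) := by
      rw [div_le_div_iff₀ (by positivity) (by linarith)]
      nlinarith [mul_le_mul_of_nonneg_left hT' (mul_pos hp hp).le]
    refine le_trans ?_ h1
    have h2 := auxPhi_harm (x - a / 2) (-(a / 2))
    rw [show x - a / 2 - -(a / 2) = x by ring, show x - a / 2 + -(a / 2) = x - a by ring] at h2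
    rw [h2, show -(-(a / 2)) ^ 2 / 2 = -a ^ 2 / 8 by ring]
    refine mul_le_mul_of_nonneg_left ?_ (exp_pos _).le
    set t := x - a / 2
    have h3 := Real.cosh_le_exp_half_sq (-(a / 2) * t)
    have h4 : exp (-b * t ^ 2) = exp (-t ^ 2 / 2) * (exp ((-(a / 2) * t) ^ 2 / 2))⁻¹ := by
      rw [← exp_neg, ← exp_add]; congr 1; rw [hb]; ring
    rw [h4, mul_inv]
    have h5 : (exp ((-(a / 2) * t) ^ 2 / 2))⁻¹ ≤ (cosh (-(a / 2) * t))⁻¹ :=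
      inv_anti₀ (by positivity) h3
    have := mul_le_mul_of_nonneg_left h5 (exp_pos (-t ^ 2 / 2)).le
    linarith
  refine le_trans ?_ hle
  rw [integral_const_mul, integral_const_mul,
    integral_sub_right_eq_self (fun x : ℝ => exp (-b * x ^ 2)), integral_gaussian, mul_comm]
  refine mul_le_mul_of_nonneg_left ?_ (exp_pos _).le
  have : 8 / 3 / a ≤ √(π / b) := by
    apply Real.le_sqrt_of_sq_le
    rw [div_pow, div_le_div_iff₀ (by positivity) hb0, hb]
    nlinarith [Real.pi_gt_three]
  have e : 4 / 3 / a = 1 / 2 * (8 / 3 / a) := by ring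
  rw [e]; linarith

lemma aux_term_le (a : ℝ) (ha : 0 < a) (x : ℝ) (k : {k : ℤ // k ≠ 0}) :
    auxPhi x * auxPhi (x + (k : ℤ) * a) / (∑' k : ℤ, auxPhi (x + k * a)) ≤
      exp (-((k : ℤ) * a / 2) ^ 2 / 2) *
        (2 * cosh (((k : ℤ) * a / 2) * (x + (k : ℤ) * a / 2)))⁻¹ := by
  have hT := auxT_ge a ha x k
  rw [auxS_eq a ha x]
  have hp := auxPhi_pos x
  have hq := auxPhi_pos (x + (k : ℤ) * a)
  have h1 : auxPhi x * auxPhi (x + (k : ℤ) * a) / (auxPhi x + ∑' k : {k : ℤ // k ≠ 0}, auxPhi (x + (k : ℤ) * a))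
      ≤ auxPhi x * auxPhi (x + (k : ℤ) * a) / (auxPhi x + auxPhi (x + (k : ℤ) * a)) := by
    gcongr
  refine h1.trans ?_
  have h2 := auxPhi_harm (x + (k : ℤ) * a / 2) ((k : ℤ) * a / 2)
  rw [show x + ((k : ℤ) : ℝ) * a / 2 - (k : ℤ) * a / 2 = x by ring,
    show x + ((k : ℤ) : ℝ) * a / 2 + (k : ℤ) * a / 2 = x + (k : ℤ) * a by ring] at h2
  rw [h2]
  refine mul_le_mul_of_nonneg_left ?_ (exp_pos _).le
  refine mul_le_of_le_one_left (by positivity) ?_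
  rw [Real.exp_le_one_iff]
  nlinarith [sq_nonneg (x + ((k : ℤ) : ℝ) * a / 2)]

lemma aux_int_k (b : ℝ) (hb : b ≠ 0) :
    ∫⁻ x : ℝ, ENNReal.ofReal (exp (-b ^ 2 / 2) * (2 * cosh (b * (x + b)))⁻¹) =
      ENNReal.ofReal (exp (-b ^ 2 / 2) * (|b|⁻¹ * (π / 2))) := by
  have hi : Integrable (fun x : ℝ => exp (-b ^ 2 / 2) * (2 * cosh (b * (x + b)))⁻¹) :=
    ((aux_sech_integrable.comp_mul_left' hb).comp_add_right b).const_mul _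
  rw [← ofReal_integral_eq_lintegral_ofReal hi (Filter.Eventually.of_forall fun x => by positivity)]
  rw [integral_const_mul, integral_add_right_eq_self (fun x : ℝ => (2 * cosh (b * x))⁻¹),
    Measure.integral_comp_mul_left (fun x : ℝ => (2 * cosh x)⁻¹), aux_sech_integral, abs_inv]
  rfl

lemma aux_upper (a : ℝ) (ha : 0 < a) (ha2 : 24 < a ^ 2) :
    ∫ x, auxG a x ≤ 7 / a * exp (-a ^ 2 / 8) := by
  set q := exp (-a ^ 2 / 8) with hq
  have hq0 : 0 < q := exp_pos _
  have hq1 : q ≤ 1 / 10 := by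
    have h1 : q ≤ exp (-3) := exp_le_exp.mpr (by linarith)
    have h2 : exp (-3) ≤ 1 / 10 := by
      rw [exp_neg, inv_eq_one_div]
      apply one_div_le_one_div_of_le (by norm_num)
      have h3 : exp 3 = exp 1 ^ 3 := by rw [← exp_nat_mul]; norm_num
      have := Real.exp_one_gt_d9
      rw [h3]
      calc (10 : ℝ) ≤ 2.7 ^ 3 := by norm_num
        _ ≤ exp 1 ^ 3 := by gcongr; linarith
    linarith
  have hs := aux_summable_pow q hq0.le (by linarith)
  have hsum := aux_split _ hs.summable
  rw [hs.tsum_eq] at hsum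
  simp only [Int.natAbs_zero, pow_zero] at hsum
  have key : ENNReal.ofReal (∫ x, auxG a x) ≤ ENNReal.ofReal (7 / a * q) := by
    rw [ofReal_integral_eq_lintegral_ofReal (auxG_integrable a ha)
      (Filter.Eventually.of_forall (auxG_nonneg a))]
    calc ∫⁻ x, ENNReal.ofReal (auxG a x)
        ≤ ∫⁻ x, ∑' k : {k : ℤ // k ≠ 0}, ENNReal.ofReal (exp (-((k : ℤ) * a / 2) ^ 2 / 2) *
        (2 * cosh (((k : ℤ) * a / 2) * (x + (k : ℤ) * a / 2)))⁻¹) := by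
          refine lintegral_mono fun x => ?_
          have hS : 0 ≤ ∑' k : ℤ, auxPhi (x + k * a) := tsum_nonneg fun _ => (auxPhi_pos _).le
          have e : auxG a x = ∑' k : {k : ℤ // k ≠ 0},
              auxPhi x * auxPhi (x + (k : ℤ) * a) / (∑' k : ℤ, auxPhi (x + k * a)) := by
            rw [tsum_div_const, tsum_mul_left, auxG]
          rw [e, ENNReal.ofReal_tsum_of_nonneg]
          · exact ENNReal.tsum_le_tsum fun k => ENNReal.ofReal_le_ofReal (aux_term_le a ha x k)
          · intro k
            exact div_nonneg (mul_nonneg (auxPhi_pos _).le (auxPhi_pos _).le) hS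
          · exact (((auxPhi_summable a ha x).subtype _).mul_left _).div_const _
      _ = ∑' k : {k : ℤ // k ≠ 0}, ENNReal.ofReal (exp (-((k : ℤ) * a / 2) ^ 2 / 2) *
            (|((k : ℤ) : ℝ) * a / 2|⁻¹ * (π / 2))) := by
          rw [lintegral_tsum]
          · congr 1
            ext k
            apply aux_int_k
            have : ((k : ℤ) : ℝ) ≠ 0 := by exact_mod_cast k.2
            positivity
          · intro k
            apply Measurable.aemeasurable
            fun_prop
      _ ≤ ∑' k : {k : ℤ // k ≠ 0}, ENNReal.ofReal (π / a * q ^ (k : ℤ).natAbs) := by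
          refine ENNReal.tsum_le_tsum fun k => ENNReal.ofReal_le_ofReal ?_
          have e : (((k : ℤ).natAbs : ℕ) : ℝ) = |((k : ℤ) : ℝ)| := by
            rw [Nat.cast_natAbs]; simp
          have h1 : (1 : ℝ) ≤ |((k : ℤ) : ℝ)| := by
            rw [← e]
            exact_mod_cast Int.natAbs_pos.mpr k.2
          have h2 : exp (-((k : ℤ) * a / 2) ^ 2 / 2) ≤ q ^ (k : ℤ).natAbs := by
            rw [hq, ← exp_nat_mul, e]
            apply exp_le_exp.mpr
            have : ((k : ℤ) : ℝ) ^ 2 ≥ |((k : ℤ) : ℝ)| := by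
              rw [← sq_abs]; nlinarith
            nlinarith [mul_le_mul_of_nonneg_left this (sq_nonneg a)]
          have h3 : |((k : ℤ) : ℝ) * a / 2|⁻¹ * (π / 2) ≤ π / a := by
            rw [abs_div, abs_mul, abs_of_pos ha, abs_two, inv_div]
            rw [div_mul_div_comm, div_le_div_iff₀ (by positivity) ha]
            have := mul_pos pi_pos ha
            nlinarith
          calc _ ≤ q ^ (k : ℤ).natAbs * (π / a) := by gcongr
            _ = _ := mul_comm _ _
      _ = ENNReal.ofReal (π / a * ∑' k : {k : ℤ // k ≠ 0}, q ^ (k : ℤ).natAbs) := by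
          rw [← tsum_mul_left, ENNReal.ofReal_tsum_of_nonneg]
          · intro k; positivity
          · exact (hs.summable.subtype _).mul_left _
      _ ≤ ENNReal.ofReal (7 / a * q) := by
          apply ENNReal.ofReal_le_ofReal
          have : ∑' k : {k : ℤ // k ≠ 0}, q ^ (k : ℤ).natAbs = 2 * q / (1 - q) := by
            have : 1 - q ≠ 0 := by linarith
            have h : ∑' k : {k : ℤ // k ≠ 0}, q ^ (k : ℤ).natAbs = 2 * (1 - q)⁻¹ - 1 - 1 := by
              linarith
            rw [h]; field_simp; ring
          have h1q : 0 < 1 - q := by linarith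
          rw [this, div_mul_div_comm, div_mul_eq_mul_div, div_le_div_iff₀ (by positivity) ha]
          have hpi := Real.pi_lt_d2
          have : π * 2 ≤ 7 * (1 - q) := by linarith
          nlinarith [mul_le_mul_of_nonneg_left this (mul_pos hq0 ha).le]
  exact (ENNReal.ofReal_le_ofReal_iff (by positivity)).mp key

lemma aux_change (θ h : ℝ) (hθ : 0 < θ) (hh : 0 < h) :
    (∫ ω : ℝ, 1 / Real.sqrt θ * Real.exp (-ω ^ 2 / (2 * θ)) *
          (∑' k : {k : ℤ // k ≠ 0},
            1 / Real.sqrt θ * Real.exp (-(ω + ((k : ℤ) : ℝ) / h) ^ 2 / (2 * θ))) /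
          ∑' k : ℤ, 1 / Real.sqrt θ * Real.exp (-(ω + (k : ℝ) / h) ^ 2 / (2 * θ)))
    = ∫ x, auxG (1 / (h * √θ)) x := by
  have hs : 0 < √θ := sqrt_pos.mpr hθ
  have e : ∀ (x : ℝ) (k : ℝ), exp (-(√θ * x + k / h) ^ 2 / (2 * θ)) = auxPhi (x + k * (1 / (h * √θ))) := by
    intro x k
    rw [auxPhi]
    congr 1
    nth_rewrite 2 [← Real.sq_sqrt hθ.le]
    field_simp
  have e0 : ∀ x : ℝ, exp (-(√θ * x) ^ 2 / (2 * θ)) = auxPhi x := by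
    intro x
    have := e x 0
    simpa using this
  have := Measure.integral_comp_mul_left (fun ω : ℝ => 1 / Real.sqrt θ * Real.exp (-ω ^ 2 / (2 * θ)) *
          (∑' k : {k : ℤ // k ≠ 0},
            1 / Real.sqrt θ * Real.exp (-(ω + ((k : ℤ) : ℝ) / h) ^ 2 / (2 * θ))) /
          ∑' k : ℤ, 1 / Real.sqrt θ * Real.exp (-(ω + (k : ℝ) / h) ^ 2 / (2 * θ))) (√θ)
  simp only [e, e0, tsum_mul_left] at this
  rw [abs_of_pos (inv_pos.mpr hs), smul_eq_mul, inv_mul_eq_div, eq_div_iff hs.ne'] at this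
  simp only [tsum_mul_left]
  rw [← this, ← integral_mul_const]
  congr 1
  ext x
  rw [auxG]
  field_simp

theorem squared_exponential_interpolation_error_bounds :
    ∃ c > (0 : ℝ), ∀ θ h : ℝ, 0 < θ → 0 < h → θ * h ^ 2 < c →
      4 / 3 * h * Real.sqrt θ * Real.exp (-(1 / (8 * h ^ 2 * θ))) ≤
        (∫ ω : ℝ, 1 / Real.sqrt θ * Real.exp (-ω ^ 2 / (2 * θ)) *
          (∑' k : {k : ℤ // k ≠ 0},
            1 / Real.sqrt θ * Real.exp (-(ω + ((k : ℤ) : ℝ) / h) ^ 2 / (2 * θ))) /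
          ∑' k : ℤ, 1 / Real.sqrt θ * Real.exp (-(ω + (k : ℝ) / h) ^ 2 / (2 * θ))) ∧
      (∫ ω : ℝ, 1 / Real.sqrt θ * Real.exp (-ω ^ 2 / (2 * θ)) *
          (∑' k : {k : ℤ // k ≠ 0},
            1 / Real.sqrt θ * Real.exp (-(ω + ((k : ℤ) : ℝ) / h) ^ 2 / (2 * θ))) /
          ∑' k : ℤ, 1 / Real.sqrt θ * Real.exp (-(ω + (k : ℝ) / h) ^ 2 / (2 * θ))) ≤
        7 * h * Real.sqrt θ * Real.exp (-(1 / (8 * h ^ 2 * θ))) := by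
  refine ⟨1 / 24, by norm_num, fun θ h hθ hh hc => ?_⟩
  have hs : 0 < √θ := sqrt_pos.mpr hθ
  have ha : 0 < 1 / (h * √θ) := by positivity
  have hsq : (1 / (h * √θ)) ^ 2 = 1 / (h ^ 2 * θ) := by
    rw [div_pow, mul_pow, Real.sq_sqrt hθ.le, one_pow]
  have ha2 : 24 < (1 / (h * √θ)) ^ 2 := by
    rw [hsq, lt_div_iff₀ (by positivity)]
    linarith
  have hl := aux_lower _ ha ha2
  have hu := aux_upper _ ha ha2
  have ee : exp (-(1 / (h * √θ)) ^ 2 / 8) = exp (-(1 / (8 * h ^ 2 * θ))) := by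
    rw [hsq]; congr 1; field_simp
  rw [ee] at hl hu
  rw [aux_change θ h hθ hh]
  constructor
  · refine le_trans (le_of_eq ?_) hl
    field_simp
  · refine hu.trans (le_of_eq ?_)
    field_simp
end
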